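/- arXiv:1002.4773 — 6 statements merged into one kernel-verified Lean document; each statement's English description precedes it below -/
import Mathlib

section
/- Let Q : ℤ → ℤ → ℝ be a Q-matrix, i.e. Q n m ≥ 0 for all m ≠ n, the family (Q n m)_{m ≠ n} is summable for each n, and Q n n = −∑_{m ≠ n} Q n m. Define ω : ℤ → ℤ → ℝ by ω n m = Q n (n+m). Then Q is stochastically monotone, i.e. for all n ∈ ℤ and all l ∈ ℤ with l ≠ n+1 one has ∑_{m ≥ l−n} ω n m ≤ ∑_{m ≥ l−n−1} ω (n+1) m, if and only if the following two separate conditions on the right and left jumps hold: (right) for all n ∈ ℤ and all k ≥ 2, ∑_{m ≥ k} ω n m ≤ ω (n+1) (k−1) + ∑_{m ≥ k} ω (n+1) m; (left) for all n ∈ ℤ and all k ≥ 2, ω n (−k+1) + ∑_{m ≥ k} ω n (−m) ≥ ∑_{m ≥ k} ω (n+1) (−m). -/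
/-- Peeling off the first term of an upper tail sum over `ℤ`. -/
theorem Summable.tsum_int_tail_eq_add {f : ℤ → ℝ} (hf : Summable f) (k : ℤ) :
    ∑' m : {m : ℤ // k - 1 ≤ m}, f m.1 = f (k - 1) + ∑' m : {m : ℤ // k ≤ m}, f m.1 := by
  have hdisj : Disjoint ({k - 1} : Set ℤ) {m | k ≤ m} := by
    simp
  have hunion : {m : ℤ | k - 1 ≤ m} = {k - 1} ∪ {m | k ≤ m} := by
    ext m
    simp only [Set.mem_ofPred_eq, Set.mem_union, Set.mem_singleton_iff]
    omega
  have h := Summable.tsum_union_disjoint hdisj (hf.subtype _) (hf.subtype _)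
  rw [← hunion, tsum_singleton (k - 1) f] at h
  exact h

/-- If a family over `ℤ` sums to zero, its reflected tail from `k` is minus its tail from
`1 - k`. -/
theorem Summable.tsum_int_neg_tail {f : ℤ → ℝ} (hf : Summable f) (h0 : ∑' m, f m = 0) (k : ℤ) :
    ∑' m : {m : ℤ // k ≤ m}, f (-m.1) = -∑' m : {m : ℤ // 1 - k ≤ m}, f m.1 := by
  have h := hf.tsum_subtype_add_tsum_subtype_compl {m : ℤ | 1 - k ≤ m}
  have e : ∑' m : {m : ℤ // k ≤ m}, f (-m.1) = ∑' m : ↥({m : ℤ | 1 - k ≤ m}ᶜ), f m.1 := by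
    refine Equiv.tsum_eq ((Equiv.neg ℤ).subtypeEquiv fun m => ?_)
      (fun m : ↥({m : ℤ | 1 - k ≤ m}ᶜ) => f m.1)
    simp only [Equiv.neg_apply, Set.mem_compl_iff, Set.mem_ofPred_eq]
    omega
  rw [h0] at h
  rw [e]
  exact eq_neg_of_add_eq_zero_right h

/-- A family that is summable off a point is summable. -/
theorem summable_of_summable_subtype_ne {q : ℤ → ℝ} {n : ℤ}
    (hs : Summable (fun m : {m : ℤ // m ≠ n} => q m.1)) : Summable q :=
  (Set.finite_singleton n).summable_compl_iff.mp hs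

/-- A family whose value at `n` is minus the sum of the other values sums to zero. -/
theorem tsum_eq_zero_of_eq_neg_tsum_subtype_ne {q : ℤ → ℝ} {n : ℤ} (hs : Summable q)
    (hd : q n = -∑' m : {m : ℤ // m ≠ n}, q m.1) : ∑' m, q m = 0 := by
  have h := hs.tsum_subtype_add_tsum_subtype_compl {n}
  rw [tsum_singleton n q, hd] at h
  rw [← h]
  exact neg_add_cancel _

/-- For a Q-matrix `Q` with jump rates `ω n m = Q n (n+m)`, stochastic
monotonicity (`∑_{m ≥ l−n} ω n m ≤ ∑_{m ≥ l−n−1} ω (n+1) m` for all `l ≠ n+1`) is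
equivalent to the pair of separate conditions on the right and left jumps. -/
theorem qmatrix_monotone_iff_right_and_left
    (Q : ℤ → ℤ → ℝ)
    (hpos : ∀ n m : ℤ, m ≠ n → 0 ≤ Q n m)
    (hsum : ∀ n : ℤ, Summable (fun m : {m : ℤ // m ≠ n} => Q n m.1))
    (hdiag : ∀ n : ℤ, Q n n = -∑' m : {m : ℤ // m ≠ n}, Q n m.1)
    (ω : ℤ → ℤ → ℝ) (hω : ∀ n m : ℤ, ω n m = Q n (n + m)) :
    (∀ n l : ℤ, l ≠ n + 1 →
        (∑' m : {m : ℤ // l - n ≤ m}, ω n m.1)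
          ≤ ∑' m : {m : ℤ // l - n - 1 ≤ m}, ω (n + 1) m.1)
      ↔
    ((∀ n k : ℤ, 2 ≤ k →
        (∑' m : {m : ℤ // k ≤ m}, ω n m.1)
          ≤ ω (n + 1) (k - 1) + ∑' m : {m : ℤ // k ≤ m}, ω (n + 1) m.1)
      ∧
     (∀ n k : ℤ, 2 ≤ k →
        (∑' m : {m : ℤ // k ≤ m}, ω (n + 1) (-m.1))
          ≤ ω n (-k + 1) + ∑' m : {m : ℤ // k ≤ m}, ω n (-m.1))) := by
  have hs (n : ℤ) : Summable (Q n) := summable_of_summable_subtype_ne (hsum n)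
  have hω' (n : ℤ) : ω n = Q n ∘ Equiv.addLeft n := funext (hω n)
  have hωs (n : ℤ) : Summable (ω n) := by
    rw [hω', Equiv.summable_iff]
    exact hs n
  have hω0 (n : ℤ) : ∑' m, ω n m = 0 := by
    rw [hω', ← tsum_eq_zero_of_eq_neg_tsum_subtype_ne (hs n) (hdiag n)]
    exact (Equiv.addLeft n).tsum_eq (Q n)
  have hneg (n k : ℤ) : ω n (-k + 1) + ∑' m : {m : ℤ // k ≤ m}, ω n (-m.1) =
      -∑' m : {m : ℤ // 2 - k ≤ m}, ω n m.1 := by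
    have h := (hωs n).tsum_int_tail_eq_add (2 - k)
    rw [show 2 - k - 1 = 1 - k by ring] at h
    rw [(hωs n).tsum_int_neg_tail (hω0 n), h, show -k + 1 = 1 - k by ring]
    ring
  simp only [hneg]
  simp only [← (hωs _).tsum_int_tail_eq_add,
    (hωs _).tsum_int_neg_tail (hω0 _), neg_le_neg_iff]
  constructor
  · refine fun h => ⟨fun n k hk => ?_, fun n k hk => ?_⟩
    · have := h n (n + k) (by omega)
      rwa [show n + k - n = k by ring] at this
    · have := h n (n + (2 - k)) (by omega)
      rwa [show n + (2 - k) - n = 2 - k by ring, show 2 - k - 1 = 1 - k by ring] at this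
  · rintro ⟨hr, hl⟩ n l hne
    rcases le_or_gt 2 (l - n) with hk | hk
    · exact hr n (l - n) hk
    · have := hl n (2 - (l - n)) (by omega)
      rwa [show 2 - (2 - (l - n)) = l - n by ring,
        show 1 - (2 - (l - n)) = l - n - 1 by ring] at this
end

section
/- Let Q : ℤ → ℤ → ℝ be a Q-matrix, i.e. Q n m ≥ 0 for all m ≠ n, the family (Q n m)_{m ≠ n} is summable for each n, and Q n n = −∑_{m ≠ n} Q n m (so each row sums to zero). Set ω n m = Q n (n+m). Then for every fixed n ∈ ℤ the following are equivalent: (i) for all l ≤ n, ∑_{j ≥ l} Q n j ≤ ∑_{j ≥ l} Q (n+1) j; (ii) for all k ≥ 2, ω n (−k+1) + ∑_{m ≥ k} ω n (−m) ≥ ∑_{m ≥ k} ω (n+1) (−m). -/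
/-- A row with summable off-diagonal entries and zero row sum has sum zero over the whole index
set. -/
theorem hasSum_zero_of_diag_eq_neg_tsum {f : ℤ → ℝ} {n : ℤ}
    (hsum : Summable fun m : {m : ℤ // m ≠ n} => f m.1)
    (hdiag : f n = -∑' m : {m : ℤ // m ≠ n}, f m.1) : HasSum f 0 := by
  have h₁ : HasSum (fun m : ({n} : Set ℤ) => f m) (f n) := by
    simpa using hasSum_unique (fun m : ({n} : Set ℤ) => f m)
  have h₂ : HasSum (fun m : (({n} : Set ℤ)ᶜ : Set ℤ) => f m)
      (∑' m : {m : ℤ // m ≠ n}, f m.1) := hsum.hasSum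
  have h := h₁.add_compl h₂
  rwa [hdiag, neg_add_cancel] at h

theorem tsum_ge_eq_neg_tsum_lt {f : ℤ → ℝ} (hf : HasSum f 0) (l : ℤ) :
    ∑' j : {j : ℤ // l ≤ j}, f j.1 = -∑' j : {j : ℤ // j < l}, f j.1 := by
  have h := hf.summable.tsum_subtype_add_tsum_subtype_compl (Set.Ici l)
  rw [hf.tsum_eq, Set.compl_Ici] at h
  exact eq_neg_of_add_eq_zero_left h

theorem tsum_lt_add_one {f : ℤ → ℝ} (hf : Summable f) (l : ℤ) :
    ∑' j : {j : ℤ // j < l + 1}, f j.1 = f l + ∑' j : {j : ℤ // j < l}, f j.1 := by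
  have hU : Set.Iio (l + 1) = {l} ∪ Set.Iio l := by
    ext j
    simp only [Set.mem_Iio, Set.mem_union, Set.mem_singleton_iff]
    omega
  have h := Summable.tsum_union_disjoint (s := {l}) (t := Set.Iio l) (by simp) (hf.subtype _) (hf.subtype _)
  rw [← hU, tsum_singleton] at h
  exact h

theorem tsum_ge_comp_add_neg (f : ℤ → ℝ) (a k : ℤ) :
    ∑' m : {m : ℤ // k ≤ m}, f (a + -m.1) = ∑' j : {j : ℤ // j < a - k + 1}, f j.1 := by
  have h : ∀ m : ℤ, k ≤ m ↔ (Equiv.subLeft a) m < a - k + 1 := fun m => by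
    simp only [Equiv.subLeft_apply]
    omega
  rw [← (Equiv.subtypeEquiv (p := fun m => k ≤ m) (q := fun j => j < a - k + 1)
    (Equiv.subLeft a) h).tsum_eq]
  simp [sub_eq_add_neg]

/-- For a Q-matrix (rows sum to zero), and fixed `n`, the stochastic
monotonicity inequalities for `l ≤ n` are equivalent to the left-jump condition. -/
theorem monotonicity_below_iff_left_jump_condition
    (Q : ℤ → ℤ → ℝ)
    (hpos : ∀ n m : ℤ, m ≠ n → 0 ≤ Q n m)
    (hsum : ∀ n : ℤ, Summable (fun m : {m : ℤ // m ≠ n} => Q n m.1))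
    (hdiag : ∀ n : ℤ, Q n n = -∑' m : {m : ℤ // m ≠ n}, Q n m.1)
    (ω : ℤ → ℤ → ℝ) (hω : ∀ n m : ℤ, ω n m = Q n (n + m))
    (n : ℤ) :
    (∀ l : ℤ, l ≤ n →
        (∑' j : {j : ℤ // l ≤ j}, Q n j.1) ≤ ∑' j : {j : ℤ // l ≤ j}, Q (n + 1) j.1)
      ↔
    (∀ k : ℤ, 2 ≤ k →
        (∑' m : {m : ℤ // k ≤ m}, ω (n + 1) (-m.1))
          ≤ ω n (-k + 1) + ∑' m : {m : ℤ // k ≤ m}, ω n (-m.1)) := by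
  have hQ := fun r => hasSum_zero_of_diag_eq_neg_tsum (hsum r) (hdiag r)
  have key : ∀ k l : ℤ, k + l = n + 2 →
      (((∑' j : {j : ℤ // l ≤ j}, Q n j.1) ≤ ∑' j : {j : ℤ // l ≤ j}, Q (n + 1) j.1) ↔
        (∑' m : {m : ℤ // k ≤ m}, ω (n + 1) (-m.1))
          ≤ ω n (-k + 1) + ∑' m : {m : ℤ // k ≤ m}, ω n (-m.1)) := by
    intro k l hkl
    obtain rfl : l = n - k + 1 + 1 := by omega
    simp only [hω]
    rw [tsum_ge_eq_neg_tsum_lt (hQ n), tsum_ge_eq_neg_tsum_lt (hQ (n + 1)), neg_le_neg_iff,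
      tsum_ge_comp_add_neg (Q n), tsum_ge_comp_add_neg (Q (n + 1)),
      tsum_lt_add_one (hQ n).summable, show n + (-k + 1) = n - k + 1 by ring,
      show n + 1 - k + 1 = n - k + 1 + 1 by ring]
  constructor
  · intro h k hk
    exact (key k (n + 2 - k) (by ring)).1 (h _ (by omega))
  · intro h l hl
    exact (key (n + 2 - l) l (by ring)).2 (h _ (by omega))
end

section
/- Let Q : ℤ → ℤ → ℝ be a Q-matrix (Q n m ≥ 0 for m ≠ n, each family (Q n m)_{m ≠ n} summable, Q n n = −∑_{m ≠ n} Q n m), set ω n m = Q n (n+m), and assume ω n m = 0 whenever |m| ≥ 2 (nearest-neighbour chain). Define the dual rates ω̃ n i = ∑_{l = −i}^{∞} (ω (n+i) l − ω (n+i−1) (l+1)). Then ω̃ n m = 0 for all |m| ≥ 2, and for all n ∈ ℤ: ω̃ n 1 = ω n (−1) and ω̃ n (−1) = ω (n−1) 1. -/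
/-- A sum over `{l ≥ a}` of a function supported on `{-2, -1, 0, 1}`. -/
theorem tsum_ge_eq_of_support (f : ℤ → ℝ) (hf : ∀ l, l < -2 ∨ 1 < l → f l = 0) (a : ℤ) :
    ∑' l : {l : ℤ // a ≤ l}, f l.1 =
      (if a ≤ -2 then f (-2) else 0) + (if a ≤ -1 then f (-1) else 0)
        + (if a ≤ 0 then f 0 else 0) + (if a ≤ 1 then f 1 else 0) := by
  refine (tsum_subtype {l : ℤ | a ≤ l} f).trans ?_
  rw [tsum_eq_sum (s := {-2, -1, 0, 1})]
  · simp [Set.indicator_apply, add_assoc]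
  · intro l hl
    simp only [Finset.mem_insert, Finset.mem_singleton, not_or] at hl
    exact Set.indicator_apply_eq_zero.2 fun _ => hf l (by lia)

/-- The sum of the off-diagonal entries in a nearest-neighbour row. -/
theorem tsum_ne_eq_of_support (f : ℤ → ℝ) (n : ℤ) (hf : ∀ m, 2 ≤ |m| → f (n + m) = 0) :
    ∑' m : {m : ℤ // m ≠ n}, f m.1 = f (n - 1) + f (n + 1) := by
  refine (tsum_subtype {m : ℤ | m ≠ n} f).trans ?_
  rw [tsum_eq_sum (s := {n - 1, n + 1})]
  · rw [Finset.sum_pair (by lia)]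
    simp
  · intro m hm
    simp only [Finset.mem_insert, Finset.mem_singleton, not_or] at hm
    refine Set.indicator_apply_eq_zero.2 fun hmn => ?_
    have hmn : m ≠ n := hmn
    simpa using hf (m - n) (by grind)

/-- For a nearest-neighbour Q-matrix, the dual jump rates
`ω̃ n i = ∑_{l=−i}^∞ (ω (n+i) l − ω (n+i−1) (l+1))` are again nearest-neighbour, with
`ω̃ n 1 = ω n (−1)` and `ω̃ n (−1) = ω (n−1) 1`. -/
theorem dual_rates_nearest_neighbour
    (Q : ℤ → ℤ → ℝ)
    (hpos : ∀ n m : ℤ, m ≠ n → 0 ≤ Q n m)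
    (hsum : ∀ n : ℤ, Summable (fun m : {m : ℤ // m ≠ n} => Q n m.1))
    (hdiag : ∀ n : ℤ, Q n n = -∑' m : {m : ℤ // m ≠ n}, Q n m.1)
    (ω : ℤ → ℤ → ℝ) (hω : ∀ n m : ℤ, ω n m = Q n (n + m))
    (hnn : ∀ n m : ℤ, 2 ≤ |m| → ω n m = 0)
    (ωd : ℤ → ℤ → ℝ)
    (hωd : ∀ n i : ℤ,
      ωd n i = ∑' l : {l : ℤ // -i ≤ l}, (ω (n + i) l.1 - ω (n + i - 1) (l.1 + 1))) :
    (∀ n m : ℤ, 2 ≤ |m| → ωd n m = 0)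
    ∧ (∀ n : ℤ, ωd n 1 = ω n (-1) ∧ ωd n (-1) = ω (n - 1) 1) := by
  have hrow (n : ℤ) : ω n (-1) + ω n 0 + ω n 1 = 0 := by
    have h := hdiag n
    rw [tsum_ne_eq_of_support (Q n) n fun m hm => hω n m ▸ hnn n m hm] at h
    rw [hω, hω, hω, add_zero, h, ← sub_eq_add_neg n 1]
    linarith
  have hz (n m : ℤ) (hm : m ≤ -2 ∨ 2 ≤ m) : ω n m = 0 := hnn n m (by grind)
  have hdual (n i : ℤ) := (hωd n i).trans <| tsum_ge_eq_of_support
    (fun l => ω (n + i) l - ω (n + i - 1) (l + 1))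
    (fun l hl => by simp only [hz _ l (by lia), hz _ (l + 1) (by lia), sub_zero]) (-i)
  refine ⟨fun n m hm => ?_, fun n => ⟨?_, ?_⟩⟩
  · rw [hdual]
    rcases le_abs.1 hm with h | h
    · have h₁ := hrow (n + m)
      have h₂ := hrow (n + m - 1)
      have h₃ := hz (n + m) (-2) (by norm_num)
      have h₄ := hz (n + m - 1) 2 (by norm_num)
      rw [if_pos (by lia), if_pos (by lia), if_pos (by lia), if_pos (by lia)]
      norm_num
      linarith
    · rw [if_neg (by lia), if_neg (by lia), if_neg (by lia), if_neg (by lia)]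
      norm_num
  · have h₁ := hrow (n + 1)
    have h₂ := hrow n
    have h₃ := hz n 2 (by norm_num)
    rw [hdual]
    norm_num
    linarith
  · have h := hz (n + -1 - 1) 2 (by norm_num)
    rw [hdual]
    norm_num [h]
    rw [sub_eq_add_neg n 1]
end

section
/- Let Q : ℤ → ℤ → ℝ be a Q-matrix (Q n m ≥ 0 for m ≠ n, each family (Q n m)_{m ≠ n} summable, Q n n = −∑_{m ≠ n} Q n m), set ω n m = Q n (n+m), and assume ω n (−i) = 0 for all n ∈ ℤ and all i > 0 (no jumps to the left). Define the dual rates ω̃ n i = ∑_{l = −i}^{∞} (ω (n+i) l − ω (n+i−1) (l+1)). Then ω̃ n i = 0 for all i > 0, and for every i > 0: ω̃ n (−i) = ω (n−i) i + ∑_{l = i+1}^{∞} (ω (n−i) l − ω (n−i−1) l). -/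
/-- A real family on `ℤ` whose value at `n` is minus the sum of its other values sums to zero. -/
theorem hasSum_zero_of_eq_neg_tsum_ne {q : ℤ → ℝ} {n : ℤ}
    (hsum : Summable (fun m : {m : ℤ // m ≠ n} => q m.1))
    (hdiag : q n = -∑' m : {m : ℤ // m ≠ n}, q m.1) : HasSum q 0 := by
  have h := (hasSum_subtype_iff_indicator (s := {m : ℤ | m ≠ n})).1 hsum.hasSum
  have h' := h.add (hasSum_ite_eq n (q n))
  convert h' using 1
  · funext m
    by_cases hm : m = n
    · simp [hm]
    · simp [hm]
  · rw [hdiag]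
    exact (add_neg_cancel _).symm

/-- Shifting the summation index of a tail by one. -/
theorem tsum_ge_comp_add_one (f : ℤ → ℝ) (k : ℤ) :
    ∑' l : {l : ℤ // k ≤ l}, f (l.1 + 1) = ∑' l : {l : ℤ // k + 1 ≤ l}, f l.1 :=
  ((Equiv.addRight (1 : ℤ)).subtypeEquiv (p := fun l => k ≤ l) (q := fun l => k + 1 ≤ l)
    (fun l => by simp)).tsum_eq (fun l : {l : ℤ // k + 1 ≤ l} => f l.1)

/-- Splitting off the first term of a tail. -/
theorem tsum_ge_eq_add_tsum_ge_add_one {f : ℤ → ℝ} (hf : Summable f) (k : ℤ) :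
    ∑' l : {l : ℤ // k ≤ l}, f l.1 = f k + ∑' l : {l : ℤ // k + 1 ≤ l}, f l.1 := by
  have h := (hasSum_ite_eq k (f k)).add
    ((hasSum_subtype_iff_indicator (s := {l : ℤ | k + 1 ≤ l})).1 (hf.subtype _).hasSum)
  refine ((hasSum_subtype_iff_indicator (s := {l : ℤ | k ≤ l})).2 ?_).tsum_eq
  convert h using 1
  · funext l
    simp only [Set.indicator_apply, Set.mem_ofPred_eq]
    rcases lt_trichotomy l k with hl | rfl | hl
    · simp [hl.ne, show ¬ k ≤ l by omega, show ¬ k + 1 ≤ l by omega]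
    · simp
    · simp [hl.ne', show k ≤ l by omega, show k + 1 ≤ l by omega]
  · rfl

/-- A tail has the full sum when the family vanishes below its starting index. -/
theorem tsum_ge_eq_tsum {f : ℤ → ℝ} {k : ℤ} (hf : ∀ l < k, f l = 0) :
    ∑' l : {l : ℤ // k ≤ l}, f l.1 = ∑' l, f l :=
  tsum_subtype_eq_of_support_subset (s := {l : ℤ | k ≤ l})
    fun l hl => not_lt.1 fun h => hl (hf l h)

/-- For a Q-matrix with no jumps to the left, the dual rates have no
jumps to the right, and for `i > 0`,
`ω̃ n (−i) = ω (n−i) i + ∑_{l=i+1}^∞ (ω (n−i) l − ω (n−i−1) l)`. -/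
theorem dual_rates_right_jumps_become_left
    (Q : ℤ → ℤ → ℝ)
    (hpos : ∀ n m : ℤ, m ≠ n → 0 ≤ Q n m)
    (hsum : ∀ n : ℤ, Summable (fun m : {m : ℤ // m ≠ n} => Q n m.1))
    (hdiag : ∀ n : ℤ, Q n n = -∑' m : {m : ℤ // m ≠ n}, Q n m.1)
    (ω : ℤ → ℤ → ℝ) (hω : ∀ n m : ℤ, ω n m = Q n (n + m))
    (hleft : ∀ n i : ℤ, 0 < i → ω n (-i) = 0)
    (ωd : ℤ → ℤ → ℝ)
    (hωd : ∀ n i : ℤ,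
      ωd n i = ∑' l : {l : ℤ // -i ≤ l}, (ω (n + i) l.1 - ω (n + i - 1) (l.1 + 1))) :
    (∀ n i : ℤ, 0 < i → ωd n i = 0)
    ∧ (∀ n i : ℤ, 0 < i →
        ωd n (-i) = ω (n - i) i
          + ∑' l : {l : ℤ // i + 1 ≤ l}, (ω (n - i) l.1 - ω (n - i - 1) l.1)) := by
  have hzero (n : ℤ) : HasSum (ω n) 0 := by
    have h := hasSum_zero_of_eq_neg_tsum_ne (hsum n) (hdiag n)
    have hshift : ω n = Q n ∘ Equiv.addLeft n := funext fun m => hω n m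
    rw [hshift]
    exact (Equiv.hasSum_iff _).2 h
  have htail (n k : ℤ) : Summable (fun l : {l : ℤ // k ≤ l} => ω n l.1) :=
    (hzero n).summable.subtype _
  have htail_succ (n k : ℤ) : Summable (fun l : {l : ℤ // k ≤ l} => ω n (l.1 + 1)) :=
    ((Equiv.summable_iff (Equiv.addRight (1 : ℤ))).2 (hzero n).summable).subtype _
  have hneg (n l : ℤ) (hl : l < 0) : ω n l = 0 := by
    simpa using hleft n (-l) (by omega)
  refine ⟨fun n i hi => ?_, fun n i hi => ?_⟩
  · rw [hωd, (htail _ _).tsum_sub (htail_succ _ _), tsum_ge_comp_add_one,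
      tsum_ge_eq_tsum fun l hl => hneg _ l (by omega),
      tsum_ge_eq_tsum fun l hl => hneg _ l (by omega),
      (hzero _).tsum_eq, (hzero _).tsum_eq, sub_zero]
  · rw [hωd, (htail _ _).tsum_sub (htail_succ _ _), tsum_ge_comp_add_one,
      (htail _ _).tsum_sub (htail _ _), neg_neg, ← sub_eq_add_neg,
      tsum_ge_eq_add_tsum_ge_add_one (hzero _).summable, add_sub_assoc]
end

section
/- Fix x ∈ ℝ and let ν be a Borel measure on ℝ with ν {0} = 0, ν {−1} = ν {1} = 0, and ∫ min(1, y²) dν(y) < ∞. Let f : ℝ → ℝ be twice continuously differentiable with compact support. For h ∈ (0,1) define L_h f(x) = ∑_{m=1}^{∞} [ f(x + m·h) − f(x) + ((f(x−h) − f(x))/h) · m·h · 1_{m·h ≤ 1} ] · ν [m·h, m·h + h) + ∑_{m=1}^{∞} [ f(x − m·h) − f(x) + ((f(x+h) − f(x))/h) · m·h · 1_{m·h ≤ 1} ] · ν (−m·h − h, −m·h]. Then L_h f(x) converges, as h → 0⁺, to ∫ ( f(x + y) − f(x) − f'(x) · y · 1_{|y| ≤ 1} ) dν(y). -/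
open MeasureTheory Filter

/-- The increment of `f` at `x` for a jump `t`, compensated with slope `c` for jumps `t ≤ 1`. -/
noncomputable def compensatedIncrement (f : ℝ → ℝ) (x c t : ℝ) : ℝ :=
  f (x + t) - f x + c * t * (if t ≤ 1 then 1 else 0)

theorem exists_abs_taylor_one_le {f : ℝ → ℝ} (hf : ContDiff ℝ 2 f) (hsupp : HasCompactSupport f) :
    ∃ K : ℝ, 0 ≤ K ∧ ∀ x y, |f (x + y) - f x - deriv f x * y| ≤ K * y ^ 2 := by
  have hd : ContDiff ℝ 1 (deriv f) := by
    have h2 : ContDiff ℝ (1 + 1) f := by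
      convert hf using 1
      norm_num
    exact (contDiff_succ_iff_deriv.1 h2).2.2
  obtain ⟨K, hK⟩ := hd.lipschitzWith_of_hasCompactSupport hsupp.deriv (by simp)
  refine ⟨K, K.2, fun x y => ?_⟩
  have hdiff : Differentiable ℝ f := hf.differentiable (by norm_num)
  have hder : ∀ t ∈ Set.uIcc 0 y, HasDerivWithinAt (fun t => f (x + t) - deriv f x * t)
      (deriv f (x + t) - deriv f x) (Set.uIcc 0 y) t := fun t _ => by
    have h1 : HasDerivAt (fun t => f (x + t)) (deriv f (x + t)) t :=
      (hdiff (x + t)).hasDerivAt.comp_const_add x t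
    have h2 : HasDerivAt (fun t => deriv f x * t) (deriv f x) t := by
      simpa using (hasDerivAt_id t).const_mul (deriv f x)
    exact (h1.sub h2).hasDerivWithinAt
  have hbound : ∀ t ∈ Set.uIcc 0 y, ‖deriv f (x + t) - deriv f x‖ ≤ K * |y| := fun t ht => by
    have h1 := hK.dist_le_mul (x + t) x
    rw [Real.dist_eq, Real.dist_eq, add_sub_cancel_left] at h1
    have h2 : |t| ≤ |y| := by simpa using Set.abs_sub_left_of_mem_uIcc ht
    exact h1.trans (mul_le_mul_of_nonneg_left h2 K.2)
  have := (convex_uIcc 0 y).norm_image_sub_le_of_norm_hasDerivWithin_le hder hbound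
    Set.left_mem_uIcc Set.right_mem_uIcc
  simp only [Real.norm_eq_abs, add_zero, mul_zero, sub_zero] at this
  calc |f (x + y) - f x - deriv f x * y| = |f (x + y) - deriv f x * y - f x| := by ring_nf
    _ ≤ K * |y| * |y| := this
    _ = K * y ^ 2 := by rw [mul_assoc, abs_mul_abs_self, sq]

theorem abs_compensatedIncrement_le {f : ℝ → ℝ} {x K M δ c t y : ℝ} (hK : 0 ≤ K)
    (hM : ∀ z, |f z| ≤ M) (hT : ∀ x y, |f (x + y) - f x - deriv f x * y| ≤ K * y ^ 2)
    (hc : |c + deriv f x| ≤ K * δ) (hδt : δ ≤ t) (ht : 0 < t) (hty : t ≤ y) :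
    |compensatedIncrement f x c t| ≤ (2 * K + 2 * M) * min 1 (y ^ 2) := by
  have hM0 : 0 ≤ M := (abs_nonneg _).trans (hM 0)
  unfold compensatedIncrement
  split_ifs with h
  · have hmin : t ^ 2 ≤ min 1 (y ^ 2) := le_min (by nlinarith) (by nlinarith)
    have h1 : |(c + deriv f x) * t| ≤ K * t ^ 2 := by
      rw [abs_mul, abs_of_pos ht]
      calc |c + deriv f x| * t ≤ K * t * t := by
            gcongr
            exact hc.trans (by gcongr)
        _ = K * t ^ 2 := by ring
    calc |f (x + t) - f x + c * t * 1|
        = |(f (x + t) - f x - deriv f x * t) + (c + deriv f x) * t| := by ring_nf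
      _ ≤ K * t ^ 2 + K * t ^ 2 := (abs_add_le _ _).trans (add_le_add (hT x t) h1)
      _ = 2 * K * t ^ 2 := by ring
      _ ≤ (2 * K + 2 * M) * min 1 (y ^ 2) := by gcongr; linarith
  · have hmin : min 1 (y ^ 2) = 1 := min_eq_left (by nlinarith)
    rw [hmin, mul_zero, add_zero]
    have h1 := abs_sub (f (x + t)) (f x)
    linarith [hM (x + t), hM x]

theorem continuousAt_compensatedIncrement {f : ℝ → ℝ} (hf : Continuous f) (x : ℝ) {c y : ℝ}
    (hy : y ≠ 1) :
    ContinuousAt (fun p : ℝ × ℝ => compensatedIncrement f x p.1 p.2) (c, y) := by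
  have hind : ContinuousAt (fun t : ℝ => if t ≤ 1 then (1 : ℝ) else 0) y := by
    rcases lt_or_gt_of_ne hy with h | h
    · refine continuousAt_const.congr (f := fun _ => 1) ?_
      filter_upwards [eventually_lt_nhds h] with t ht
      rw [if_pos ht.le]
    · refine continuousAt_const.congr (f := fun _ => 0) ?_
      filter_upwards [eventually_gt_nhds h] with t ht
      rw [if_neg (not_le.2 ht)]
  have hind2 : ContinuousAt (fun p : ℝ × ℝ => if p.2 ≤ 1 then (1 : ℝ) else 0) (c, y) :=
    ContinuousAt.comp (f := Prod.snd) (g := fun t : ℝ => if t ≤ 1 then (1 : ℝ) else 0)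
      hind continuousAt_snd
  unfold compensatedIncrement
  refine ContinuousAt.add ?_ (ContinuousAt.mul ?_ hind2)
  · fun_prop
  · fun_prop

theorem measurable_compensatedIncrement {f : ℝ → ℝ} (hf : Continuous f) (x c : ℝ) :
    Measurable (compensatedIncrement f x c) := by
  unfold compensatedIncrement
  have : Measurable fun t : ℝ => if t ≤ 1 then (1 : ℝ) else 0 :=
    Measurable.ite measurableSet_Iic measurable_const measurable_const
  have := hf.measurable
  fun_prop

theorem mem_Ico_mul_iff_floor {h y : ℝ} (hh : 0 < h) {m : ℕ} (hm : 1 ≤ m) :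
    y ∈ Set.Ico ((m : ℝ) * h) (m * h + h) ↔ ⌊y / h⌋₊ = m := by
  rw [Nat.floor_eq_iff' (by omega), le_div_iff₀ hh, div_lt_iff₀ hh, add_mul, one_mul]
  rfl

theorem iUnion_Ico_mul_eq_Ici {h : ℝ} (hh : 0 < h) :
    ⋃ m : {m : ℕ // 1 ≤ m}, Set.Ico ((m.1 : ℝ) * h) (m.1 * h + h) = Set.Ici h := by
  ext y
  simp only [Set.mem_iUnion, Set.mem_Ici]
  constructor
  · rintro ⟨⟨m, hm⟩, hy, -⟩
    have : (1 : ℝ) ≤ m := by exact_mod_cast hm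
    nlinarith
  · intro hy
    have h1 : 1 ≤ ⌊y / h⌋₊ := Nat.le_floor (by rw [le_div_iff₀ hh]; simpa using hy)
    exact ⟨⟨_, h1⟩, (mem_Ico_mul_iff_floor hh h1).2 rfl⟩

theorem setIntegral_floor_eq_tsum (ν : Measure ℝ) {h : ℝ} (hh : 0 < h) (φ : ℕ → ℝ)
    (hφ : IntegrableOn (fun y => φ ⌊y / h⌋₊) (Set.Ici h) ν) :
    ∫ y in Set.Ici h, φ ⌊y / h⌋₊ ∂ν =
      ∑' m : {m : ℕ // 1 ≤ m}, φ m * (ν (Set.Ico ((m.1 : ℝ) * h) (m.1 * h + h))).toReal := by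
  rw [← iUnion_Ico_mul_eq_Ici hh] at hφ ⊢
  rw [integral_iUnion (fun _ => measurableSet_Ico) _ hφ]
  · refine tsum_congr fun m => ?_
    rw [setIntegral_congr_fun (g := fun _ => φ m) measurableSet_Ico fun y hy => by
      simp only [(mem_Ico_mul_iff_floor hh m.2).1 hy]]
    rw [setIntegral_const, smul_eq_mul, mul_comm, measureReal_def]
  · intro m n hmn
    refine Set.disjoint_left.2 fun y hy hy' => hmn (Subtype.ext ?_)
    rw [← (mem_Ico_mul_iff_floor hh m.2).1 hy, (mem_Ico_mul_iff_floor hh n.2).1 hy']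

theorem tendsto_floor_div_mul (y : ℝ) (hy : 0 < y) :
    Tendsto (fun h : ℝ => (⌊y / h⌋₊ : ℝ) * h) (nhdsWithin 0 (Set.Ioo 0 1)) (nhds y) := by
  have hid : Tendsto (fun h : ℝ => h) (nhdsWithin 0 (Set.Ioo 0 1)) (nhds 0) :=
    tendsto_id.mono_left nhdsWithin_le_nhds
  refine tendsto_of_tendsto_of_tendsto_of_le_of_le' (g := fun h => y - h) (h := fun _ => y)
    (by simpa using tendsto_const_nhds.sub hid) tendsto_const_nhds ?_ ?_
  · filter_upwards [self_mem_nhdsWithin] with h hh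
    have := Nat.lt_floor_add_one (y / h)
    rw [div_lt_iff₀ hh.1] at this
    linarith
  · filter_upwards [self_mem_nhdsWithin] with h hh
    exact (le_div_iff₀ hh.1).1 (Nat.floor_le (div_nonneg hy.le hh.1.le))

theorem integrable_min_one_sq {ν : Measure ℝ}
    (hmom : ∫⁻ y, ENNReal.ofReal (min 1 (y ^ 2)) ∂ν < ⊤) :
    Integrable (fun y : ℝ => min 1 (y ^ 2)) ν := by
  refine ⟨by fun_prop, ?_⟩
  rw [hasFiniteIntegral_iff_ofReal (ae_of_all _ fun y => le_min zero_le_one (sq_nonneg y))]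
  exact hmom

theorem integrableOn_compensatedIncrement (x : ℝ) {ν : Measure ℝ}
    (hmom : ∫⁻ y, ENNReal.ofReal (min 1 (y ^ 2)) ∂ν < ⊤)
    {f : ℝ → ℝ} (hf : ContDiff ℝ 2 f) (hsupp : HasCompactSupport f) :
    IntegrableOn (compensatedIncrement f x (-deriv f x)) (Set.Ioi 0) ν := by
  obtain ⟨K, hK, hT⟩ := exists_abs_taylor_one_le hf hsupp
  obtain ⟨M, hM⟩ := hsupp.exists_bound_of_continuous hf.continuous
  refine Integrable.mono' ((integrable_min_one_sq hmom).const_mul (2 * K + 2 * M)).integrableOn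
    (measurable_compensatedIncrement hf.continuous x _).aestronglyMeasurable ?_
  filter_upwards [ae_restrict_mem measurableSet_Ioi] with y hy
  exact abs_compensatedIncrement_le (δ := 0) hK hM hT (by simp) (le_of_lt hy) hy le_rfl

theorem tendsto_tsum_compensatedIncrement (x : ℝ) {ν : Measure ℝ} (hp1 : ν {1} = 0)
    (hmom : ∫⁻ y, ENNReal.ofReal (min 1 (y ^ 2)) ∂ν < ⊤)
    {f : ℝ → ℝ} (hf : ContDiff ℝ 2 f) (hsupp : HasCompactSupport f) :
    Tendsto (fun h : ℝ => ∑' m : {m : ℕ // 1 ≤ m},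
        compensatedIncrement f x ((f (x - h) - f x) / h) ((m.1 : ℝ) * h)
          * (ν (Set.Ico ((m.1 : ℝ) * h) ((m.1 : ℝ) * h + h))).toReal)
      (nhdsWithin 0 (Set.Ioo (0 : ℝ) 1))
      (nhds (∫ y in Set.Ioi 0, compensatedIncrement f x (-deriv f x) y ∂ν)) := by
  obtain ⟨K, hK, hT⟩ := exists_abs_taylor_one_le hf hsupp
  obtain ⟨M, hM⟩ := hsupp.exists_bound_of_continuous hf.continuous
  have hslope : ∀ h : ℝ, 0 < h → |(f (x - h) - f x) / h + deriv f x| ≤ K * h := fun h hh => by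
    have h1 := hT x (-h)
    have h2 : (f (x - h) - f x) / h + deriv f x
        = (f (x + -h) - f x - deriv f x * -h) / h := by
      rw [← sub_eq_add_neg]
      field_simp
      ring
    rw [h2, abs_div, abs_of_pos hh, div_le_iff₀ hh]
    linarith
  have hslope_lim : Tendsto (fun h => (f (x - h) - f x) / h) (nhdsWithin 0 (Set.Ioo (0 : ℝ) 1))
      (nhds (-deriv f x)) := by
    rw [tendsto_iff_norm_sub_tendsto_zero]
    refine squeeze_zero' (g := fun h => K * h) (Eventually.of_forall fun _ => norm_nonneg _) ?_ ?_
    · filter_upwards [self_mem_nhdsWithin] with h hh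
      simpa using hslope h hh.1
    · have : Tendsto (fun h : ℝ => K * h) (nhds 0) (nhds (K * 0)) := tendsto_id.const_mul K
      rw [mul_zero] at this
      exact this.mono_left nhdsWithin_le_nhds
  set φ : ℝ → ℕ → ℝ := fun h m =>
    compensatedIncrement f x ((f (x - h) - f x) / h) ((m : ℝ) * h) with hφ
  have hmeas : ∀ h, Measurable fun y : ℝ => φ h ⌊y / h⌋₊ := fun h =>
    (measurable_from_nat (f := φ h)).comp (Nat.measurable_floor.comp (measurable_id.div_const h))
  have hbound : ∀ h, 0 < h → ∀ y, h ≤ y →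
      ‖φ h ⌊y / h⌋₊‖ ≤ (2 * K + 2 * M) * min 1 (y ^ 2) := fun h hh y hy => by
    have h1 : 1 ≤ ⌊y / h⌋₊ := Nat.le_floor (by rw [le_div_iff₀ hh]; simpa using hy)
    have h1' : (1 : ℝ) ≤ ⌊y / h⌋₊ := by exact_mod_cast h1
    exact abs_compensatedIncrement_le hK hM hT (hslope h hh) (by nlinarith) (by positivity)
      ((mem_Ico_mul_iff_floor hh h1).2 rfl).1
  have hdomI := (integrable_min_one_sq hmom).const_mul (2 * K + 2 * M)
  have hM0 : 0 ≤ M := (norm_nonneg _).trans (hM 0)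
  have hlim : Tendsto (fun h => ∫ y in Set.Ioi 0,
        (Set.Ici h).indicator (fun y => φ h ⌊y / h⌋₊) y ∂ν)
      (nhdsWithin 0 (Set.Ioo (0 : ℝ) 1))
      (nhds (∫ y in Set.Ioi 0, compensatedIncrement f x (-deriv f x) y ∂ν)) := by
    refine tendsto_integral_filter_of_dominated_convergence
      (fun y => (2 * K + 2 * M) * min 1 (y ^ 2)) ?_ ?_ hdomI.integrableOn ?_
    · exact Eventually.of_forall fun h =>
        ((hmeas h).indicator measurableSet_Ici).aestronglyMeasurable
    · filter_upwards [self_mem_nhdsWithin] with h hh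
      refine ae_of_all _ fun y => ?_
      by_cases hy : h ≤ y
      · rw [Set.indicator_of_mem (Set.mem_Ici.2 hy)]
        exact hbound h hh.1 y hy
      · rw [Set.indicator_of_notMem (by simpa using hy), norm_zero]
        positivity
    · have hne : ∀ᵐ y ∂ν.restrict (Set.Ioi 0), y ≠ 1 :=
        ae_restrict_of_ae (measure_eq_zero_iff_ae_notMem.1 hp1)
      filter_upwards [hne, ae_restrict_mem measurableSet_Ioi] with y hy1 hy0
      have hJ := (continuousAt_compensatedIncrement hf.continuous x
        (c := -deriv f x) hy1).tendsto.comp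
          (hslope_lim.prodMk_nhds (tendsto_floor_div_mul y hy0))
      refine hJ.congr' ?_
      filter_upwards [nhdsWithin_le_nhds (eventually_lt_nhds (Set.mem_Ioi.1 hy0))] with h hh
      rw [Set.indicator_of_mem (Set.mem_Ici.2 hh.le)]
      rfl
  refine hlim.congr' ?_
  filter_upwards [self_mem_nhdsWithin] with h hh
  have hsub : Set.Ioi 0 ∩ Set.Ici h = Set.Ici h :=
    Set.inter_eq_right.2 fun y hy => lt_of_lt_of_le hh.1 hy
  rw [setIntegral_indicator measurableSet_Ici, hsub]
  refine setIntegral_floor_eq_tsum ν hh.1 (φ h) (Integrable.mono' hdomI.integrableOn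
    (hmeas h).aestronglyMeasurable ?_)
  filter_upwards [ae_restrict_mem measurableSet_Ici] with y hy
  exact hbound h hh.1 y hy

/-- the lattice discretization `L_h f(x)` of the jump part of a
Lévy–Khintchine generator converges, as `h → 0⁺` (with `h ∈ (0,1)`), to
`∫ (f(x+y) − f(x) − f'(x)·y·1_{|y|≤1}) dν(y)`. -/
theorem discretized_jump_generator_tendsto
    (x : ℝ) (ν : Measure ℝ)
    (h0 : ν {0} = 0) (hm1 : ν {-1} = 0) (hp1 : ν {1} = 0)
    (hmom : ∫⁻ y, ENNReal.ofReal (min 1 (y ^ 2)) ∂ν < ⊤)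
    (f : ℝ → ℝ) (hf : ContDiff ℝ 2 f) (hsupp : HasCompactSupport f) :
    Tendsto
      (fun h : ℝ =>
        (∑' m : {m : ℕ // 1 ≤ m},
            (f (x + (m.1 : ℝ) * h) - f x
              + ((f (x - h) - f x) / h) * ((m.1 : ℝ) * h)
                  * (if (m.1 : ℝ) * h ≤ 1 then 1 else 0))
            * (ν (Set.Ico ((m.1 : ℝ) * h) ((m.1 : ℝ) * h + h))).toReal)
        + ∑' m : {m : ℕ // 1 ≤ m},
            (f (x - (m.1 : ℝ) * h) - f x
              + ((f (x + h) - f x) / h) * ((m.1 : ℝ) * h)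
                  * (if (m.1 : ℝ) * h ≤ 1 then 1 else 0))
            * (ν (Set.Ioc (-((m.1 : ℝ) * h) - h) (-((m.1 : ℝ) * h)))).toReal)
      (nhdsWithin 0 (Set.Ioo (0 : ℝ) 1))
      (nhds (∫ y, (f (x + y) - f x
        - deriv f x * y * (if |y| ≤ 1 then 1 else 0)) ∂ν)) := by
  set g : ℝ → ℝ := fun t => f (-t) with hg
  have hgc : ContDiff ℝ 2 g := hf.comp contDiff_neg
  have hgs : HasCompactSupport g := hsupp.comp_homeomorph (Homeomorph.neg ℝ)
  have hgd : deriv g (-x) = -deriv f x := by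
    rw [hg, deriv_comp_neg, neg_neg]
  have hmap1 : (ν.map Neg.neg) {1} = 0 := by
    rw [Measure.map_apply measurable_neg (measurableSet_singleton 1)]
    simpa using hm1
  have hmapmom : ∫⁻ y, ENNReal.ofReal (min 1 (y ^ 2)) ∂(ν.map Neg.neg) < ⊤ := by
    rw [lintegral_map (by fun_prop) measurable_neg]
    simpa using hmom
  have hpos := tendsto_tsum_compensatedIncrement x hp1 hmom hf hsupp
  have hneg := tendsto_tsum_compensatedIncrement (-x) hmap1 hmapmom hgc hgs
  have hposI := integrableOn_compensatedIncrement x hmom hf hsupp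
  have hnegI := integrableOn_compensatedIncrement (-x) hmapmom hgc hgs
  set F : ℝ → ℝ := fun y => f (x + y) - f x - deriv f x * y * (if |y| ≤ 1 then 1 else 0) with hF
  have hFpos : Set.EqOn (compensatedIncrement f x (-deriv f x)) F (Set.Ioi 0) := fun y hy => by
    simp only [compensatedIncrement, hF, abs_of_pos (Set.mem_Ioi.1 hy)]
    ring
  have hFneg : Set.EqOn (fun y => compensatedIncrement g (-x) (-deriv g (-x)) (-y)) F
      (Set.Iio 0) := fun y hy => by
    simp only [compensatedIncrement, hF, abs_of_neg (Set.mem_Iio.1 hy), hgd]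
    simp only [hg, neg_add_rev, neg_neg, add_comm y x]
    ring
  have hpre : (Neg.neg : ℝ → ℝ) ⁻¹' Set.Ioi 0 = Set.Iio 0 := by
    ext
    simp
  have hemb : MeasurableEmbedding (Neg.neg : ℝ → ℝ) := (MeasurableEquiv.neg ℝ).measurableEmbedding
  rw [hemb.setIntegral_map, hpre, setIntegral_congr_fun measurableSet_Iio hFneg] at hneg
  rw [hemb.integrableOn_map_iff, hpre] at hnegI
  rw [setIntegral_congr_fun measurableSet_Ioi hFpos] at hpos
  have hsplit : ∫ y, F y ∂ν = (∫ y in Set.Ioi 0, F y ∂ν) + ∫ y in Set.Iio 0, F y ∂ν := by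
    have hdisj : Disjoint (Set.Ioi (0 : ℝ)) (Set.Iio 0) :=
      Set.disjoint_left.2 fun y hy hy' => lt_asymm (Set.mem_Ioi.1 hy) hy'
    rw [← setIntegral_union hdisj measurableSet_Iio (hposI.congr_fun hFpos measurableSet_Ioi)
      (hnegI.congr_fun hFneg measurableSet_Iio), Set.union_comm, Set.Iio_union_Ioi,
      ← setIntegral_univ]
    refine (setIntegral_congr_set ?_).symm
    exact ae_eq_univ.2 (by simpa using h0)
  rw [hsplit]
  refine (hpos.add hneg).congr fun h => ?_
  congr 1
  refine tsum_congr fun m => ?_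
  rw [Measure.map_apply measurable_neg measurableSet_Ico]
  congr 2
  · simp only [compensatedIncrement, hg]
    ring_nf
  · congr 1
    ext y
    simp only [Set.mem_preimage, Set.mem_Ico, Set.mem_Ioc]
    constructor <;> rintro ⟨h1, h2⟩ <;> constructor <;> linarith
end

section
/- Let G : ℝ → ℝ be differentiable at x and f : ℝ → ℝ be twice differentiable at x. Then the limit as h → 0⁺ of (2h²)^{−1} · [ G(x)·f(x+h) + G(x−h)·f(x−h) − (G(x) + G(x−h))·f(x) ] exists and equals (1/2)·( G(x)·f''(x) + G'(x)·f'(x) ). -/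
open Filter

/-- Taylor–Young expansion of order two at a point, in quotient form. -/
theorem tendsto_second_order_taylor_quotient {f : ℝ → ℝ} {x : ℝ}
    (hf : ∀ᶠ y in nhds x, DifferentiableAt ℝ f y)
    (hf' : DifferentiableAt ℝ (deriv f) x) :
    Tendsto (fun t : ℝ => (f (x + t) - f x - deriv f x * t) / t ^ 2)
      (nhdsWithin 0 {0}ᶜ) (nhds (deriv (deriv f) x / 2)) := by
  have hadd : Tendsto (fun t : ℝ => x + t) (nhds 0) (nhds x) := by
    simpa using (continuous_const_add x).tendsto (0 : ℝ)
  refine HasDerivAt.lhopital_zero_nhdsNE (f' := fun t => deriv f (x + t) - deriv f x)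
    (g' := fun t => 2 * t) ?_ ?_ ?_ ?_ ?_ ?_
  · refine ((hadd.eventually hf).filter_mono nhdsWithin_le_nhds).mono fun t ht => ?_
    have h := (ht.hasDerivAt.comp_const_add x t).sub_const (f x)
    simpa using h.fun_sub ((hasDerivAt_id t).const_mul (deriv f x))
  · exact Eventually.of_forall fun t => by simpa using hasDerivAt_pow 2 t
  · filter_upwards [self_mem_nhdsWithin] with t ht
    exact mul_ne_zero two_ne_zero ht
  · have h : Tendsto (fun t : ℝ => f (x + t) - f x - deriv f x * t) (nhds 0)
        (nhds (f x - f x - deriv f x * 0)) :=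
      ((hf.self_of_nhds.continuousAt.tendsto.comp hadd).sub_const (f x)).sub
        (tendsto_id.const_mul (deriv f x))
    simpa using h.mono_left nhdsWithin_le_nhds
  · have h : Tendsto (fun t : ℝ => t ^ 2) (nhds 0) (nhds (0 ^ 2)) := (continuous_pow 2).tendsto 0
    simpa using h.mono_left nhdsWithin_le_nhds
  · refine (hf'.hasDerivAt.tendsto_slope_zero.div_const 2).congr fun t => ?_
    simp only [smul_eq_mul, div_eq_mul_inv, mul_inv]
    ring

/-- the dual discretized diffusion operator converges, as `h → 0⁺`,
to `(1/2)(G(x) f''(x) + G'(x) f'(x))`. -/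
theorem dual_diffusion_discretization_tendsto
    (G f : ℝ → ℝ) (x : ℝ)
    (hG : DifferentiableAt ℝ G x)
    (hf : ∀ᶠ y in nhds x, DifferentiableAt ℝ f y)
    (hf' : DifferentiableAt ℝ (deriv f) x) :
    Tendsto
      (fun h : ℝ => (2 * h ^ 2)⁻¹
        * (G x * f (x + h) + G (x - h) * f (x - h) - (G x + G (x - h)) * f x))
      (nhdsWithin 0 (Set.Ioi (0 : ℝ)))
      (nhds ((1 / 2) * (G x * deriv (deriv f) x + deriv G x * deriv f x))) := by
  have hpos : Tendsto (fun h : ℝ => h) (nhdsWithin 0 (Set.Ioi 0)) (nhdsWithin 0 {0}ᶜ) :=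
    tendsto_id.mono_left (nhdsWithin_mono 0 fun _ h => ne_of_gt h)
  have hneg : Tendsto (fun h : ℝ => -h) (nhdsWithin 0 (Set.Ioi 0)) (nhdsWithin 0 {0}ᶜ) := by
    refine tendsto_nhdsWithin_iff.2 ⟨?_, ?_⟩
    · simpa using ((continuous_neg.tendsto (0 : ℝ)).mono_left nhdsWithin_le_nhds :
        Tendsto (fun h : ℝ => -h) (nhdsWithin 0 (Set.Ioi 0)) _)
    · filter_upwards [self_mem_nhdsWithin] with h hh
      exact neg_ne_zero.2 (ne_of_gt hh)
  have hT := tendsto_second_order_taylor_quotient hf hf'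
  have hGx : Tendsto (fun h : ℝ => G (x + -h)) (nhdsWithin 0 (Set.Ioi 0)) (nhds (G x)) := by
    refine hG.continuousAt.tendsto.comp ?_
    simpa using (hneg.mono_right nhdsWithin_le_nhds).const_add x
  have key := ((((hG.hasDerivAt.tendsto_slope_zero.comp hneg).mul_const (deriv f x)).add
    ((hT.comp hpos).const_mul (G x))).add (hGx.mul (hT.comp hneg))).const_mul (1 / 2)
  convert key.congr' ?_ using 2
  · ring
  · filter_upwards [self_mem_nhdsWithin] with h hh
    have h0 : h ≠ 0 := ne_of_gt hh
    simp only [Function.comp_apply, smul_eq_mul, sub_eq_add_neg x h]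
    field_simp
    ring
end
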